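/- Let K : ℝ → ℝ be continuous and without conjugate points, and let k > 0 satisfy K(t) > −k² for all t ∈ ℝ. If J : ℝ → ℝ is a solution of the Jacobi equation J''(t) + K(t)·J(t) = 0 with J(0) = 0, then for every R > 0 there exists T > 0 such that |J(t)| ≥ R·|J'(0)| for all t ≥ T. -/

import Mathlib

open Set MeasureTheory Filter

/-- A solution of the scalar Jacobi equation `J'' + K·J = 0`. -/
def IsJacobiSolution (K J : ℝ → ℝ) : Prop :=
  ContDiff ℝ 2 J ∧ ∀ t : ℝ, deriv (deriv J) t + K t * J t = 0

/-- `K` is without conjugate points: any solution vanishing at two distinct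
points vanishes identically. -/
def WithoutConjugatePoints (K : ℝ → ℝ) : Prop :=
  ∀ J : ℝ → ℝ, IsJacobiSolution K J →
    ∀ a b : ℝ, a ≠ b → J a = 0 → J b = 0 → ∀ t : ℝ, J t = 0

namespace IsJacobiSolution

variable {K J : ℝ → ℝ}

theorem hasDerivAt (hJ : IsJacobiSolution K J) (t : ℝ) : HasDerivAt J (deriv J t) t :=
  (hJ.1.differentiable (by norm_num) t).hasDerivAt

theorem hasDerivAt_deriv (hJ : IsJacobiSolution K J) (t : ℝ) :
    HasDerivAt (deriv J) (-(K t * J t)) t := by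
  have h : ContDiff ℝ 1 (deriv J) := by
    have h2 : ContDiff ℝ (1 + 1) J := by
      have := hJ.1
      norm_num
      exact this
    exact (contDiff_succ_iff_deriv.1 h2).2.2
  have h' := (h.differentiable (by norm_num) t).hasDerivAt
  rwa [eq_neg_of_add_eq_zero_left (hJ.2 t)] at h'

theorem continuous (hJ : IsJacobiSolution K J) : Continuous J := hJ.1.continuous

theorem continuous_deriv (hJ : IsJacobiSolution K J) : Continuous (deriv J) :=
  continuous_iff_continuousAt.2 fun t => (hJ.hasDerivAt_deriv t).continuousAt

theorem of_hasDerivAt (hK : Continuous K) {V : ℝ → ℝ} (hJ : ∀ t, HasDerivAt J (V t) t)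
    (hV : ∀ t, HasDerivAt V (-(K t * J t)) t) : IsJacobiSolution K J := by
  have hJV : deriv J = V := funext fun t => (hJ t).deriv
  have hVK : deriv V = fun t => -(K t * J t) := funext fun t => (hV t).deriv
  have hJc : Continuous J := continuous_iff_continuousAt.2 fun t => (hJ t).continuousAt
  have hV1 : ContDiff ℝ 1 V := by
    rw [contDiff_one_iff_deriv, hVK]
    exact ⟨fun t => (hV t).differentiableAt, by fun_prop⟩
  refine ⟨?_, fun t => ?_⟩
  · have h2 : ContDiff ℝ (1 + 1) J := by
      rw [contDiff_succ_iff_deriv, hJV]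
      exact ⟨fun t => (hJ t).differentiableAt, by simp, hV1⟩
    norm_num at h2
    exact h2
  · rw [hJV, hVK]
    ring

theorem neg (hJ : IsJacobiSolution K J) (hK : Continuous K) : IsJacobiSolution K (-J) :=
  of_hasDerivAt hK (fun t => (hJ.hasDerivAt t).neg) fun t =>
    (hJ.hasDerivAt_deriv t).neg.congr_deriv (by simp)

theorem sub_const_mul {D : ℝ → ℝ} (hD : IsJacobiSolution K D) (hJ : IsJacobiSolution K J)
    (hK : Continuous K) (m : ℝ) : IsJacobiSolution K fun t => D t - m * J t :=
  of_hasDerivAt hK (fun t => (hD.hasDerivAt t).sub ((hJ.hasDerivAt t).const_mul m)) fun t =>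
    ((hD.hasDerivAt_deriv t).sub ((hJ.hasDerivAt_deriv t).const_mul m)).congr_deriv (by ring)

/-- Rofe-Beketov's formula: a solution that never vanishes together with its derivative has a
globally defined companion solution with Wronskian `-1`. -/
theorem exists_wronskian_eq_neg_one (hK : Continuous K) (hJ : IsJacobiSolution K J)
    (hρ : ∀ t, J t ^ 2 + deriv J t ^ 2 ≠ 0) :
    ∃ D, IsJacobiSolution K D ∧ ∀ t, deriv D t * J t - D t * deriv J t = -1 := by
  set V := deriv J
  have hJc := hJ.continuous
  have hVc : Continuous V := hJ.continuous_deriv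
  have hJd : ∀ t, HasDerivAt J (V t) t := hJ.hasDerivAt
  have hVd : ∀ t, HasDerivAt V (-(K t * J t)) t := hJ.hasDerivAt_deriv
  set w : ℝ → ℝ := fun t => (1 - K t) * (V t ^ 2 - J t ^ 2) / (J t ^ 2 + V t ^ 2) ^ 2 with hw
  have hwc : Continuous w :=
    Continuous.div (by fun_prop) (by fun_prop) fun t => pow_ne_zero 2 (hρ t)
  set I : ℝ → ℝ := fun t => ∫ s in (0 : ℝ)..t, w s
  have hI : ∀ t, HasDerivAt I (w t) t := fun t => hwc.integral_hasStrictDerivAt 0 t |>.hasDerivAt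
  have hρd : ∀ t, HasDerivAt (fun t => J t ^ 2 + V t ^ 2) (2 * J t * V t * (1 - K t)) t :=
    fun t => (((hJd t).pow 2).add ((hVd t).pow 2)).congr_deriv (by push_cast; ring)
  have hD : ∀ t, HasDerivAt (fun t => V t / (J t ^ 2 + V t ^ 2) + J t * I t)
      (-J t / (J t ^ 2 + V t ^ 2) + V t * I t) t := fun t => by
    refine (((hVd t).div (hρd t) (hρ t)).add ((hJd t).mul (hI t))).congr_deriv ?_
    have := hρ t
    simp only [hw]
    field_simp
    ring
  have hE : ∀ t, HasDerivAt (fun t => -J t / (J t ^ 2 + V t ^ 2) + V t * I t)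
      (-(K t * (V t / (J t ^ 2 + V t ^ 2) + J t * I t))) t := fun t => by
    refine (((hJd t).neg.div (hρd t) (hρ t)).add ((hVd t).mul (hI t))).congr_deriv ?_
    have := hρ t
    simp only [hw, Pi.neg_apply]
    field_simp
    ring
  refine ⟨_, of_hasDerivAt hK hD hE, fun t => ?_⟩
  rw [(hD t).deriv]
  have := hρ t
  field_simp
  ring

theorem pos_of_deriv_pos (hJ : IsJacobiSolution K J) (hwcp : WithoutConjugatePoints K)
    (hJ0 : J 0 = 0) (hd : 0 < deriv J 0) {t : ℝ} (ht : 0 < t) : 0 < J t := by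
  have hne : ∀ s, 0 < s → J s ≠ 0 := fun s hs h => by
    have hz : J = fun _ => 0 := funext (hwcp J hJ 0 s hs.ne hJ0 h)
    simp [hz] at hd
  by_contra! hle
  have hslope := (hJ.hasDerivAt 0).tendsto_slope.eventually (lt_mem_nhds hd)
  have hev : ∀ᶠ s in nhdsWithin (0 : ℝ) (Ioi 0), 0 < J s := by
    filter_upwards [hslope.filter_mono (nhdsWithin_mono 0 fun x (hx : 0 < x) => hx.ne'),
      self_mem_nhdsWithin] with s hs hs0
    rw [slope_def_field, hJ0, sub_zero, sub_zero] at hs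
    exact (div_pos_iff_of_pos_right hs0).1 hs
  obtain ⟨s, hsJ, hs⟩ := (hev.and (Ioo_mem_nhdsGT ht)).exists
  obtain ⟨x, hx, hx0⟩ := intermediate_value_Icc' hs.2.le hJ.continuous.continuousOn ⟨hle, hsJ.le⟩
  exact hne x (hs.1.trans_le hx.1) hx0

/-- Sturm comparison with the constant curvature `-k ^ 2`. -/
theorem antitoneOn_div_sinh (hJ : IsJacobiSolution K J) (hJ0 : J 0 = 0) {k : ℝ} (hk : 0 < k)
    (hKk : ∀ t, -k ^ 2 < K t) (hpos : ∀ t, 0 < t → 0 < J t) :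
    AntitoneOn (fun t => J t / Real.sinh (k * t)) (Ioi 0) := by
  have hS : ∀ t, HasDerivAt (fun t => Real.sinh (k * t)) (Real.cosh (k * t) * k) t := fun t => by
    simpa using ((hasDerivAt_id t).const_mul k).sinh
  have hC : ∀ t, HasDerivAt (fun t => Real.cosh (k * t)) (Real.sinh (k * t) * k) t := fun t => by
    simpa using ((hasDerivAt_id t).const_mul k).cosh
  have hSpos : ∀ t, 0 < t → 0 < Real.sinh (k * t) := fun t ht =>
    Real.sinh_pos_iff.2 (mul_pos hk ht)
  have hW : ∀ t, HasDerivAt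
      (fun t => deriv J t * Real.sinh (k * t) - J t * (Real.cosh (k * t) * k))
      (-((K t + k ^ 2) * (J t * Real.sinh (k * t)))) t := fun t =>
    (((hJ.hasDerivAt_deriv t).mul (hS t)).sub
      ((hJ.hasDerivAt t).mul ((hC t).mul_const k))).congr_deriv (by ring)
  have hWanti : AntitoneOn
      (fun t => deriv J t * Real.sinh (k * t) - J t * (Real.cosh (k * t) * k)) (Ici 0) := by
    refine antitoneOn_of_deriv_nonpos (convex_Ici 0)
      (fun t _ => (hW t).continuousAt.continuousWithinAt)
      (fun t _ => (hW t).differentiableAt.differentiableWithinAt) fun t ht => ?_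
    rw [interior_Ici] at ht
    rw [(hW t).deriv, neg_nonpos]
    exact mul_nonneg (by linarith [hKk t]) (mul_pos (hpos t ht) (hSpos t ht)).le
  have hq : ∀ t, 0 < t → HasDerivAt (fun t => J t / Real.sinh (k * t)) _ t := fun t ht =>
    (hJ.hasDerivAt t).div (hS t) (hSpos t ht).ne'
  refine antitoneOn_of_deriv_nonpos (convex_Ioi 0)
    (fun t ht => (hq t ht).continuousAt.continuousWithinAt)
    (fun t ht => ?_) fun t ht => ?_
  · rw [interior_Ioi] at ht
    exact (hq t ht).differentiableAt.differentiableWithinAt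
  · rw [interior_Ioi] at ht
    rw [(hq t ht).deriv]
    refine div_nonpos_of_nonpos_of_nonneg ?_ (sq_nonneg _)
    have := hWanti self_mem_Ici (mem_Ici.2 (le_of_lt ht)) (le_of_lt ht)
    simpa [hJ0] using this

theorem le_two_mul_cosh_mul (hJ : IsJacobiSolution K J) (hJ0 : J 0 = 0) {k : ℝ} (hk : 0 < k)
    (hKk : ∀ t, -k ^ 2 < K t) (hpos : ∀ t, 0 < t → 0 < J t) {s x : ℝ} (hs : 1 ≤ s)
    (hsx : s ≤ x) (hxs : x ≤ s + 1) : J x ≤ 2 * Real.cosh k * J s := by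
  have hs0 : 0 < s := by linarith
  have hx0 : 0 < x := by linarith
  have hq : J x / Real.sinh (k * x) ≤ J s / Real.sinh (k * s) :=
    hJ.antitoneOn_div_sinh hJ0 hk hKk hpos hs0 hx0 hsx
  have hSs : 0 < Real.sinh (k * s) := Real.sinh_pos_iff.2 (mul_pos hk hs0)
  have hSx : 0 < Real.sinh (k * x) := Real.sinh_pos_iff.2 (mul_pos hk hx0)
  have hratio : Real.sinh (k * x) ≤ 2 * Real.cosh k * Real.sinh (k * s) := by
    have h1 : Real.sinh (k * x) ≤ Real.sinh (k * s + k) := Real.sinh_le_sinh.2 (by nlinarith)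
    have h2 : 0 ≤ Real.sinh (k * s - k) := Real.sinh_nonneg_iff.2 (by nlinarith)
    rw [Real.sinh_add] at h1
    rw [Real.sinh_sub] at h2
    linarith
  rw [div_le_div_iff₀ hSx hSs] at hq
  have := mul_le_mul_of_nonneg_left hratio (hpos s hs0).le
  refine le_of_mul_le_mul_right (?_ : _ * Real.sinh (k * s) ≤ _ * Real.sinh (k * s)) hSs
  linarith

theorem tendsto_atTop (hK : Continuous K) (hwcp : WithoutConjugatePoints K) {k : ℝ} (hk : 0 < k)
    (hKk : ∀ t, -k ^ 2 < K t) (hJ : IsJacobiSolution K J) (hJ0 : J 0 = 0)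
    (hd : 0 < deriv J 0) : Tendsto J atTop atTop := by
  have hpos : ∀ t, 0 < t → 0 < J t := fun t ht => hJ.pos_of_deriv_pos hwcp hJ0 hd ht
  have hne : ∀ t, t ≠ 0 → J t ≠ 0 := fun t ht h => by
    have hz : J = fun _ => 0 := funext (hwcp J hJ 0 t ht.symm hJ0 h)
    simp [hz] at hd
  have hρ : ∀ t, J t ^ 2 + deriv J t ^ 2 ≠ 0 := fun t => by
    rcases eq_or_ne t 0 with rfl | ht
    · positivity
    · have := hne t ht
      positivity
  obtain ⟨D, hD, hDJ⟩ := hJ.exists_wronskian_eq_neg_one hK hρ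
  have hD0 : 0 < D 0 := by
    have h := hDJ 0
    rw [hJ0] at h
    exact pos_of_mul_pos_left (by linarith : 0 < D 0 * deriv J 0) hd.le
  have hJn : J (-1) ≠ 0 := hne _ (by norm_num)
  obtain ⟨m, hm⟩ : ∃ m, D (-1) - m * J (-1) = 0 := ⟨D (-1) / J (-1), by field_simp; ring⟩
  have hU := hD.sub_const_mul hJ hK m
  have hbelow : ∀ t, 0 < t → m < D t / J t := fun t ht => by
    rw [lt_div_iff₀ (hpos t ht)]
    by_contra! hle
    obtain ⟨x, hx, hx0⟩ := intermediate_value_Icc' ht.le hU.continuous.continuousOn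
      (show (0 : ℝ) ∈ Icc _ _ from ⟨by linarith, by simp [hJ0, hD0.le]⟩)
    have := hwcp _ hU (-1) x (by linarith [hx.1]) hm hx0 0
    simp [hJ0, hD0.ne'] at this
  have hg : ∀ t, 0 < t → HasDerivAt (fun t => D t / J t) (-1 / J t ^ 2) t := fun t ht => by
    rw [← hDJ t]
    exact (hD.hasDerivAt t).div (hJ.hasDerivAt t) (hpos t ht).ne'
  have hanti : AntitoneOn (fun t => D t / J t) (Ioi 0) := by
    refine antitoneOn_of_deriv_nonpos (convex_Ioi 0)
      (fun t ht => (hg t ht).continuousAt.continuousWithinAt) (fun t ht => ?_) fun t ht => ?_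
    · rw [interior_Ioi] at ht
      exact (hg t ht).differentiableAt.differentiableWithinAt
    · rw [interior_Ioi] at ht
      rw [(hg t ht).deriv]
      exact div_nonpos_of_nonpos_of_nonneg (by norm_num) (sq_nonneg _)
  obtain ⟨l, hl⟩ : ∃ l, Tendsto (fun t => D t / J t) atTop (nhds l) := by
    have hmono : Antitone fun t => D (max 1 t) / J (max 1 t) := fun a b hab =>
      hanti (mem_Ioi.2 (lt_max_of_lt_left one_pos)) (mem_Ioi.2 (lt_max_of_lt_left one_pos))
        (max_le_max_left 1 hab)
    refine ⟨_, (tendsto_atTop_ciInf hmono ⟨m, ?_⟩).congr' ?_⟩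
    · rintro _ ⟨t, rfl⟩
      exact (hbelow _ (lt_max_of_lt_left one_pos)).le
    · filter_upwards [eventually_ge_atTop 1] with t ht
      rw [max_eq_right ht]
  have hdiff : Tendsto (fun t => D t / J t - D (t + 1) / J (t + 1)) atTop (nhds 0) := by
    simpa using hl.sub (hl.comp (tendsto_atTop_add_const_right atTop 1 tendsto_id))
  refine Filter.tendsto_atTop.2 fun b => ?_
  set M := 2 * Real.cosh k
  have hM : 0 < M := mul_pos two_pos (Real.cosh_pos k)
  set B := M * (|b| + 1)
  have hB : 0 < B := by positivity
  have hε : 0 < 1 / B ^ 2 := by positivity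
  filter_upwards [hdiff.eventually (gt_mem_nhds hε), eventually_ge_atTop 1] with s hs hs1
  have hs0 : 0 < s := by linarith
  obtain ⟨x, hx, hxd⟩ := exists_hasDerivAt_eq_slope (fun t => D t / J t) (fun t => -1 / J t ^ 2)
    (lt_add_one s)
    (fun t ht => (hg t (hs0.trans_le ht.1)).continuousAt.continuousWithinAt)
    (fun t ht => hg t (hs0.trans ht.1))
  have hJx : 0 < J x := hpos x (hs0.trans hx.1)
  have hlt : 1 / J x ^ 2 < 1 / B ^ 2 := by
    rw [add_sub_cancel_left, div_one, neg_div] at hxd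
    linarith
  have hBx : B < J x :=
    lt_of_pow_lt_pow_left₀ 2 hJx.le ((one_div_lt_one_div (by positivity) (by positivity)).1 hlt)
  have hle := hJ.le_two_mul_cosh_mul hJ0 hk hKk hpos hs1 hx.1.le hx.2.le
  have hbs : |b| + 1 < J s := lt_of_mul_lt_mul_left (hBx.trans_le hle) hM.le
  linarith [le_abs_self b]

end IsJacobiSolution

theorem stmt_14 (K : ℝ → ℝ) (hK : Continuous K)
    (hwcp : WithoutConjugatePoints K) (k : ℝ) (hk : 0 < k)
    (hKk : ∀ t : ℝ, -k ^ 2 < K t)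
    (J : ℝ → ℝ) (hJ : IsJacobiSolution K J) (hJ0 : J 0 = 0) :
    ∀ R : ℝ, 0 < R → ∃ T : ℝ, 0 < T ∧ ∀ t : ℝ, T ≤ t →
      R * |deriv J 0| ≤ |J t| := by
  intro R _
  have habs : ∀ᶠ t in atTop, R * |deriv J 0| ≤ |J t| := by
    rcases lt_trichotomy (deriv J 0) 0 with hd | hd | hd
    · have hd' : 0 < deriv (-J) 0 := by simpa [deriv.neg] using hd
      filter_upwards [((hJ.neg hK).tendsto_atTop hK hwcp hk hKk (by simpa using hJ0)
        hd').eventually_ge_atTop (R * |deriv J 0|)] with t ht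
      exact ht.trans (neg_le_abs (J t))
    · simp [hd]
    · filter_upwards [(hJ.tendsto_atTop hK hwcp hk hKk hJ0
        hd).eventually_ge_atTop (R * |deriv J 0|)] with t ht
      exact ht.trans (le_abs_self (J t))
  obtain ⟨T, hT⟩ := eventually_atTop.1 habs
  exact ⟨max T 1, lt_max_of_lt_right one_pos, fun t ht => hT t ((le_max_left T 1).trans ht)⟩
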